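/- Let n ≥ 5 and let P₀ : Fin n → ℝ² be a configuration of n labeled points (injective, in general position); call a subset H ⊆ Fin n an important set if H is the extreme set of some configuration Q on Fin n with the same radial system as P₀. If H₁ and H₂ are two disjoint important sets, then both H₁ and H₂ have cardinality exactly 3, and every important set equals H₁ or H₂. -/

import Mathlib

noncomputable def det2 (v w : ℝ × ℝ) : ℝ := v.1 * w.2 - v.2 * w.1

noncomputable def chi {α : Type*} (P : α → ℝ × ℝ) (i j k : α) : ℝ :=
  Real.sign (det2 (P j - P i) (P k - P i))

def GenPos {α : Type*} (P : α → ℝ × ℝ) : Prop :=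
  ∀ i j k : α, i ≠ j → i ≠ k → j ≠ k → chi P i j k ≠ 0

def Ccw {α : Type*} (P : α → ℝ × ℝ) (i j k l : α) : Prop :=
  (chi P i j k = 1 ∧ chi P i k l = 1) ∨
  (chi P i k l = 1 ∧ chi P i l j = 1) ∨
  (chi P i l j = 1 ∧ chi P i j k = 1)

def Admissible {α : Type*} (i j k l : α) : Prop :=
  i ≠ j ∧ i ≠ k ∧ i ≠ l ∧ j ≠ k ∧ j ≠ l ∧ k ≠ l

def SameRadial {α : Type*} (P Q : α → ℝ × ℝ) : Prop :=
  ∀ i j k l : α, Admissible i j k l → (Ccw P i j k l ↔ Ccw Q i j k l)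

def SameUndirected {α : Type*} (P Q : α → ℝ × ℝ) : Prop :=
  ∀ i : α, (∀ j k l : α, Admissible i j k l → (Ccw Q i j k l ↔ Ccw P i j k l)) ∨
           (∀ j k l : α, Admissible i j k l → (Ccw Q i j k l ↔ Ccw P i l k j))

def ExtremeSet {α : Type*} (P : α → ℝ × ℝ) : Set α :=
  {i | P i ∉ convexHull ℝ (P '' {j | j ≠ i})}

def Important {n : ℕ} (P₀ : Fin n → ℝ × ℝ) (H : Set (Fin n)) : Prop :=
  ∃ Q : Fin n → ℝ × ℝ, Function.Injective Q ∧ GenPos Q ∧ SameRadial P₀ Q ∧ ExtremeSet Q = H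

def lineThrough (p q : ℝ × ℝ) : Set (ℝ × ℝ) := {x | ∃ t : ℝ, x = p + t • (q - p)}

/-- Twice the signed area of the triangle `P i, P j, P k`. -/
noncomputable def area {α : Type*} (P : α → ℝ × ℝ) (i j k : α) : ℝ :=
  det2 (P j - P i) (P k - P i)

/-- The triangle `i, j, k` is positively oriented. -/
def Pos {α : Type*} (P : α → ℝ × ℝ) (i j k : α) : Prop := 0 < area P i j k

/-- The point `l` lies inside the positively oriented triangle `i, j, k`. -/
def Inside {α : Type*} (P : α → ℝ × ℝ) (i j k l : α) : Prop :=
  Pos P i j l ∧ Pos P j k l ∧ Pos P k i l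

section Orientation

variable {α : Type*} {P Q : α → ℝ × ℝ} {a b c d e f i j k l : α}

lemma chi_eq_one_iff : chi P i j k = 1 ↔ Pos P i j k := by
  unfold chi Pos area
  rcases lt_trichotomy (det2 (P j - P i) (P k - P i)) 0 with h | h | h
  · rw [Real.sign_of_neg h]
    constructor <;> intro h' <;> linarith
  · simp [h]
  · simp [Real.sign_of_pos h, h]

lemma area_rotate (P : α → ℝ × ℝ) (i j k : α) : area P j k i = area P i j k := by
  simp only [area, det2, Prod.fst_sub, Prod.snd_sub]; ring

lemma area_swap (P : α → ℝ × ℝ) (i j k : α) : area P i k j = -area P i j k := by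
  simp only [area, det2, Prod.fst_sub, Prod.snd_sub]; ring

lemma area_split (P : α → ℝ × ℝ) (i j k l : α) :
    area P i j k = area P i j l + area P j k l + area P k i l := by
  simp only [area, det2, Prod.fst_sub, Prod.snd_sub]; ring

lemma Pos.rotate (h : Pos P i j k) : Pos P j k i := by
  unfold Pos at *; rwa [area_rotate]

lemma pos_rotate_iff : Pos P j k i ↔ Pos P i j k :=
  ⟨fun h => h.rotate.rotate, Pos.rotate⟩

lemma GenPos.area_ne_zero (hP : GenPos P) (hij : i ≠ j) (hik : i ≠ k) (hjk : j ≠ k) :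
    area P i j k ≠ 0 := by
  intro h
  apply hP i j k hij hik hjk
  unfold chi
  unfold area at h
  rw [h, Real.sign_zero]

lemma Pos.not_swap (h : Pos P i j k) : ¬ Pos P i k j := by
  unfold Pos at *
  rw [area_swap]
  linarith

lemma GenPos.pos_swap_iff (hP : GenPos P) (hij : i ≠ j) (hik : i ≠ k) (hjk : j ≠ k) :
    Pos P i k j ↔ ¬ Pos P i j k := by
  have := hP.area_ne_zero hij hik hjk
  unfold Pos
  rw [area_swap]
  constructor
  · intro h; linarith
  · intro h
    have := lt_of_le_of_ne (not_lt.mp h) this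
    linarith

lemma Inside.pos (h : Inside P i j k l) : Pos P i j k := by
  obtain ⟨h1, h2, h3⟩ := h
  unfold Pos at *
  rw [area_split P i j k l]
  linarith

lemma ccw_iff : Ccw P i j k l ↔
    (Pos P i j k ∧ Pos P i k l) ∨ (Pos P i k l ∧ Pos P i l j) ∨ (Pos P i l j ∧ Pos P i j k) := by
  simp only [Ccw, chi_eq_one_iff]

/-- The six orderings of a triple are all determined by one of them. -/
lemma GenPos.pos_orderings (hP : GenPos P) (hij : i ≠ j) (hik : i ≠ k) (hjk : j ≠ k) :
    (Pos P j k i ↔ Pos P i j k) ∧ (Pos P k i j ↔ Pos P i j k) ∧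
    (Pos P i k j ↔ ¬ Pos P i j k) ∧ (Pos P k j i ↔ ¬ Pos P i j k) ∧
    (Pos P j i k ↔ ¬ Pos P i j k) := by
  have h := hP.pos_swap_iff hij hik hjk
  refine ⟨pos_rotate_iff, ?_, h, ?_, ?_⟩
  · rw [pos_rotate_iff, pos_rotate_iff]
  · rw [pos_rotate_iff, h]
  · rw [← pos_rotate_iff, h]

/-- The four orientations of a quadruple cannot form one of the two sign patterns which are not
acyclic. -/
lemma GenPos.pos_of_split (hP : GenPos P) (h : Admissible a b c d) :
    (Pos P a b d → Pos P b c d → ¬ Pos P a c d → Pos P a b c) ∧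
    (¬ Pos P a b d → ¬ Pos P b c d → Pos P a c d → ¬ Pos P a b c) := by
  obtain ⟨hab, hac, had, hbc, hbd, hcd⟩ := h
  have h1 := area_split P a b c d
  have h2 : area P c a d = - area P a c d := by rw [area_swap P c d a, area_rotate]
  have h3 := hP.area_ne_zero hac had hcd
  unfold Pos
  constructor
  · intro h4 h5 h6
    linarith
  · intro h4 h5 h6
    linarith

/-- If the orientation of the triangle `a, b, c` differs in two configurations with the same radial
system, then every fourth point lies inside the triangle in exactly one of them, while in the other
one a vertex of the triangle lies inside the triangle of the remaining three points. -/
lemma SameRadial.inside_of_flip (hPQ : SameRadial P Q) (hP : GenPos P) (hQ : GenPos Q)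
    (h : Admissible a b c d) (hp : Pos P a b c) (hq : Pos Q a c b) :
    (Inside P a b c d ∧ (Inside Q d c b a ∨ Inside Q a c d b ∨ Inside Q a d b c)) ∨
    (Inside Q a c b d ∧ (Inside P d b c a ∨ Inside P a d c b ∨ Inside P a b d c)) := by
  have ha := hPQ a b c d h
  obtain ⟨hab, hac, had, hbc, hbd, hcd⟩ := h
  have hb := hPQ b a c d ⟨hab.symm, hbc, hbd, hac, had, hcd⟩
  have hc := hPQ c a b d ⟨hac.symm, hbc.symm, hcd, hab, had, hbd⟩
  have hd := hPQ d a b c ⟨had.symm, hbd.symm, hcd.symm, hab, hac, hbc⟩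
  have hsP := hP.pos_of_split ⟨hab, hac, had, hbc, hbd, hcd⟩
  have hsQ := hQ.pos_of_split ⟨hab, hac, had, hbc, hbd, hcd⟩
  simp only [ccw_iff] at ha hb hc hd
  unfold Inside
  obtain ⟨p1, p2, p3, p4, p5⟩ := hP.pos_orderings hab hac hbc
  obtain ⟨p6, p7, p8, p9, p10⟩ := hP.pos_orderings hab had hbd
  obtain ⟨p11, p12, p13, p14, p15⟩ := hP.pos_orderings hac had hcd
  obtain ⟨p16, p17, p18, p19, p20⟩ := hP.pos_orderings hbc hbd hcd
  obtain ⟨q1, q2, q3, q4, q5⟩ := hQ.pos_orderings hab hac hbc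
  obtain ⟨q6, q7, q8, q9, q10⟩ := hQ.pos_orderings hab had hbd
  obtain ⟨q11, q12, q13, q14, q15⟩ := hQ.pos_orderings hac had hcd
  obtain ⟨q16, q17, q18, q19, q20⟩ := hQ.pos_orderings hbc hbd hcd
  simp only [p1, p2, p3, p4, p5, p6, p7, p8, p9, p10, p11, p12, p13, p14, p15, p16, p17, p18, p19,
    p20, q1, q2, q3, q4, q5, q6, q7, q8, q9, q10, q11, q12, q13, q14, q15, q16, q17, q18, q19, q20]
    at *
  clear p1 p2 p3 p4 p5 p6 p7 p8 p9 p10 p11 p12 p13 p14 p15 p16 p17 p18 p19 p20 q1 q2 q3 q4 q5 q6 q7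
    q8 q9 q10 q11 q12 q13 q14 q15 q16 q17 q18 q19 q20
  grind

lemma Inside.mem_convexHull (h : Inside P i j k l) :
    P l ∈ convexHull ℝ (P '' {m | m ≠ l}) := by
  have hpos := h.pos
  obtain ⟨h1, h2, h3⟩ := h
  unfold Pos at hpos h1 h2 h3
  have hil : i ≠ l := by rintro rfl; simp [area, det2] at h1
  have hjl : j ≠ l := by rintro rfl; simp [area, det2] at h2
  have hkl : k ≠ l := by rintro rfl; simp [area, det2] at h3
  have hmem : ∀ m, m ≠ l → P m ∈ convexHull ℝ (P '' {m | m ≠ l}) := fun m hm =>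
    subset_convexHull ℝ _ ⟨m, hm, rfl⟩
  have hsum := (convex_convexHull ℝ (P '' {m | m ≠ l})).sum_mem (t := Finset.univ)
    (w := ![area P j k l / area P i j k, area P k i l / area P i j k, area P i j l / area P i j k])
    (z := ![P i, P j, P k])
    (by intro m _; fin_cases m <;> simp <;> positivity)
    (by
      simp only [Fin.sum_univ_three, Matrix.cons_val]
      rw [← add_div, ← add_div, div_eq_one_iff_eq hpos.ne', area_split P i j k l]
      ring)
    (by intro m _; fin_cases m <;> simp [hmem, hil, hjl, hkl])
  convert hsum using 1
  simp only [Fin.sum_univ_three, Matrix.cons_val]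
  have hne := hpos.ne'
  ext
  · simp only [Prod.fst_add, Prod.smul_fst, smul_eq_mul]
    field_simp
    simp only [area, det2, Prod.fst_sub, Prod.snd_sub]
    ring
  · simp only [Prod.snd_add, Prod.smul_snd, smul_eq_mul]
    field_simp
    simp only [area, det2, Prod.fst_sub, Prod.snd_sub]
    ring

lemma exists_inside_of_mem_convexHull (hinj : Function.Injective P) (hP : GenPos P)
    (h : P l ∈ convexHull ℝ (P '' {m | m ≠ l})) : ∃ i j k, Inside P i j k l := by
  obtain ⟨ι, _, z, w, hz, hind, hw, hw1, hsum⟩ := eq_pos_convex_span_of_mem_convexHull h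
  have hz' : ∀ x, ∃ m, m ≠ l ∧ P m = z x := fun x => hz ⟨x, rfl⟩
  choose p hpl hpz using hz'
  have hpinj : ∀ x y, x ≠ y → p x ≠ p y := fun x y hxy hp =>
    hxy (hind.injective (by rw [← hpz, ← hpz, hp]))
  have hcard : Fintype.card ι ≤ 3 := by
    refine hind.card_le_finrank_succ.trans ?_
    have := Submodule.finrank_le (vectorSpan ℝ (Set.range z))
    rw [Module.finrank_prod, Module.finrank_self] at this
    omega
  have e := Fintype.equivFin ι
  generalize Fintype.card ι = m at hcard e
  rw [← e.symm.sum_comp] at hw1 hsum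
  interval_cases m
  · simp at hw1
  · simp only [Fin.sum_univ_one] at hw1 hsum
    rw [hw1, one_smul, ← hpz] at hsum
    exact absurd (hinj hsum) (hpl _)
  · simp only [Fin.sum_univ_two] at hw1 hsum
    have hne : e.symm 0 ≠ e.symm 1 := by simp
    generalize e.symm 0 = x at *
    generalize e.symm 1 = y at *
    rw [← hpz, ← hpz] at hsum
    refine absurd ?_ (hP.area_ne_zero (hpinj x y hne) (hpl x) (hpl y))
    have hwx : w x = 1 - w y := by linarith
    simp only [area, ← hsum, det2, Prod.fst_sub, Prod.snd_sub, Prod.fst_add, Prod.snd_add,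
      Prod.smul_fst, Prod.smul_snd, smul_eq_mul, hwx]
    ring
  · simp only [Fin.sum_univ_three] at hw1 hsum
    have h01 : e.symm 0 ≠ e.symm 1 := by simp
    have h02 : e.symm 0 ≠ e.symm 2 := by simp
    have h12 : e.symm 1 ≠ e.symm 2 := by simp
    generalize e.symm 0 = x at *
    generalize e.symm 1 = y at *
    generalize e.symm 2 = t at *
    rw [← hpz, ← hpz, ← hpz] at hsum
    have hwx : w x = 1 - w y - w t := by linarith
    have hA := hP.area_ne_zero (hpinj x y h01) (hpinj x t h02) (hpinj y t h12)
    have h1 : area P (p x) (p y) l = w t * area P (p x) (p y) (p t) := by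
      simp only [area, ← hsum, det2, Prod.fst_sub, Prod.snd_sub, Prod.fst_add, Prod.snd_add,
        Prod.smul_fst, Prod.smul_snd, smul_eq_mul, hwx]
      ring
    have h2 : area P (p y) (p t) l = w x * area P (p x) (p y) (p t) := by
      simp only [area, ← hsum, det2, Prod.fst_sub, Prod.snd_sub, Prod.fst_add, Prod.snd_add,
        Prod.smul_fst, Prod.smul_snd, smul_eq_mul, hwx]
      ring
    have h3 : area P (p t) (p x) l = w y * area P (p x) (p y) (p t) := by
      simp only [area, ← hsum, det2, Prod.fst_sub, Prod.snd_sub, Prod.fst_add, Prod.snd_add,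
        Prod.smul_fst, Prod.smul_snd, smul_eq_mul, hwx]
      ring
    have hwx := hw x
    have hwy := hw y
    have hwt := hw t
    rcases lt_or_gt_of_ne hA with hA | hA
    · refine ⟨p y, p x, p t, ?_, ?_, ?_⟩ <;> unfold Pos
      · rw [← area_rotate, area_swap, h1]; nlinarith
      · rw [← area_rotate, area_swap, h3]; nlinarith
      · rw [← area_rotate, area_swap, h2]; nlinarith
    · refine ⟨p x, p y, p t, ?_, ?_, ?_⟩ <;> unfold Pos
      · rw [h1]; positivity
      · rw [h2]; positivity
      · rw [h3]; positivity

lemma mem_extremeSet_iff (hinj : Function.Injective P) (hP : GenPos P) :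
    l ∈ ExtremeSet P ↔ ∀ i j k, ¬ Inside P i j k l := by
  constructor
  · intro h i j k hin
    exact h hin.mem_convexHull
  · intro h hmem
    obtain ⟨i, j, k, hin⟩ := exists_inside_of_mem_convexHull hinj hP hmem
    exact h i j k hin

lemma extremeSet_nonempty [Finite α] [Nonempty α] (hinj : Function.Injective P) :
    (ExtremeSet P).Nonempty := by
  obtain ⟨x, hx⟩ := ((Set.finite_range P).isCompact_convexHull ℝ).extremePoints_nonempty
    ((Set.range_nonempty P).mono (subset_convexHull ℝ _))
  obtain ⟨i, rfl⟩ := extremePoints_convexHull_subset hx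
  refine ⟨i, fun hmem => ?_⟩
  rw [(convex_convexHull ℝ _).mem_extremePoints_iff_mem_sdiff_convexHull_sdiff] at hx
  refine hx.2 (convexHull_mono ?_ hmem)
  rintro _ ⟨j, hj, rfl⟩
  exact ⟨subset_convexHull ℝ _ ⟨j, rfl⟩, fun h => hj (hinj h)⟩

/-- If a positively oriented triangle contains all other points, then it is the extreme set. -/
lemma extremeSet_eq_of_forall_inside (hinj : Function.Injective P) (hP : GenPos P)
    (h : Pos P a b c) (hin : ∀ d, d ≠ a → d ≠ b → d ≠ c → Inside P a b c d) :
    ExtremeSet P = {a, b, c} := by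
  have hvertex : ∀ a b c, Pos P a b c →
      (∀ d, d ≠ a → d ≠ b → d ≠ c → Inside P a b c d) → a ∈ ExtremeSet P := by
    intro a b c h hin
    rw [mem_extremeSet_iff hinj hP]
    intro x y z hxyz
    have hpos := hxyz.pos
    have hlt : ∀ x, x ≠ a → area P b c x < area P b c a := by
      intro x hxa
      unfold Pos at h
      by_cases hxb : x = b
      · subst hxb
        rw [area_rotate P a x c]
        simpa [area, det2] using h
      by_cases hxc : x = c
      · subst hxc
        rw [area_rotate P a b x]
        convert h using 1
        simp only [area, det2]; ring
      obtain ⟨h1, h2, h3⟩ := hin x hxa hxb hxc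
      unfold Pos at h1 h2 h3
      rw [area_rotate P a b c, area_split P a b c x]
      linarith
    obtain ⟨h1, h2, h3⟩ := hxyz
    unfold Pos at *
    have hx := hlt x (by rintro rfl; simp [area, det2] at h1)
    have hy := hlt y (by rintro rfl; simp [area, det2] at h2)
    have hz := hlt z (by rintro rfl; simp [area, det2] at h3)
    have hid : area P b c a * area P x y z = area P y z a * area P b c x +
        area P z x a * area P b c y + area P x y a * area P b c z := by
      simp only [area, det2, Prod.fst_sub, Prod.snd_sub]; ring
    rw [area_split P x y z a] at hid
    nlinarith
  ext l
  constructor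
  · intro hl
    by_contra hne
    simp only [Set.mem_insert_iff, Set.mem_singleton_iff, not_or] at hne
    exact (mem_extremeSet_iff hinj hP).1 hl a b c (hin l hne.1 hne.2.1 hne.2.2)
  · rintro (rfl | rfl | rfl)
    · exact hvertex _ _ _ h hin
    · exact hvertex _ _ _ h.rotate fun d h1 h2 h3 =>
        let ⟨i1, i2, i3⟩ := hin d h3 h1 h2; ⟨i2, i3, i1⟩
    · exact hvertex _ _ _ h.rotate.rotate fun d h1 h2 h3 =>
        let ⟨i1, i2, i3⟩ := hin d h2 h3 h1; ⟨i3, i1, i2⟩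

lemma SameRadial.symm (h : SameRadial P Q) : SameRadial Q P :=
  fun i j k l hadm => (h i j k l hadm).symm

lemma SameRadial.trans {R : α → ℝ × ℝ} (h : SameRadial P Q) (h' : SameRadial Q R) :
    SameRadial P R :=
  fun i j k l hadm => (h i j k l hadm).trans (h' i j k l hadm)

lemma Pos.ne (h : Pos P i j k) : i ≠ j ∧ i ≠ k ∧ j ≠ k := by
  unfold Pos at h
  refine ⟨?_, ?_, ?_⟩ <;> rintro rfl
  · simp [area, det2] at h
  · simp [area, det2] at h
  · simp only [area, det2] at h
    linarith

/-- If two configurations with the same radial system have different chirotopes, then the extreme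
set of each is a triangle whose orientation differs in the two configurations. -/
lemma SameRadial.exists_extremeSet_eq [Finite α] (hPQ : SameRadial P Q)
    (hinj : Function.Injective P) (hP : GenPos P) (hQ : GenPos Q)
    (h : Pos P i j k) (h' : Pos Q i k j) :
    ∃ a b c, Pos P a b c ∧ Pos Q a c b ∧ ExtremeSet P = {a, b, c} := by
  obtain ⟨⟨a, b, c⟩, ⟨hp, hq⟩, hmax⟩ := Set.exists_max_image
    {t : α × α × α | Pos P t.1 t.2.1 t.2.2 ∧ Pos Q t.1 t.2.2 t.2.1}
    (fun t => area P t.1 t.2.1 t.2.2) (Set.toFinite _) ⟨(i, j, k), h, h'⟩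
  refine ⟨a, b, c, hp, hq, extremeSet_eq_of_forall_inside hinj hP hp fun d hda hdb hdc => ?_⟩
  obtain ⟨hab, hac, hbc⟩ := hp.ne
  simp only at hp hq
  rcases hPQ.inside_of_flip hP hQ ⟨hab, hac, hda.symm, hbc, hdb.symm, hdc.symm⟩ hp hq with
    ⟨hin, -⟩ | ⟨⟨q1, q2, q3⟩, hin⟩
  · exact hin
  exfalso
  rcases hin with hin | hin | hin
  · have := hmax (d, b, c) ⟨hin.pos, q2.rotate.rotate⟩
    obtain ⟨p1, p2, p3⟩ := hin
    have hs := area_split P d b c a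
    have := area_rotate P a b c
    simp only [Pos] at *
    linarith
  · have := hmax (a, d, c) ⟨hin.pos, q1⟩
    obtain ⟨p1, p2, p3⟩ := hin
    have hs := area_split P a d c b
    have := area_rotate P c a b
    have := area_rotate P a b c
    simp only [Pos] at *
    linarith
  · have := hmax (a, b, d) ⟨hin.pos, q3.rotate⟩
    obtain ⟨p1, p2, p3⟩ := hin
    have hs := area_split P a b d c
    simp only [Pos] at *
    linarith

lemma Inside.rotate (h : Inside P i j k l) : Inside P j k i l :=
  ⟨h.2.1, h.2.2, h.1⟩

/-- Configurations with the same radial system agree on quadrilaterals in convex position. -/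
lemma SameRadial.pos_of_convex (hPQ : SameRadial P Q) (hP : GenPos P) (hQ : GenPos Q)
    (h1 : Pos P a b c) (h2 : Pos P b c d) (h3 : Pos P c d a) (h4 : Pos P d a b) :
    Pos Q a b c ∧ Pos Q b c d ∧ Pos Q c d a ∧ Pos Q d a b := by
  have key : ∀ a b c d, Pos P a b c → Pos P b c d → Pos P c d a → Pos P d a b → Pos Q a b c := by
    intro a b c d h1 h2 h3 h4
    obtain ⟨hab, hac, hbc⟩ := h1.ne
    have hadm : Admissible a b c d := ⟨hab, hac, h3.ne.2.2.symm, hbc, h2.ne.2.1, h2.ne.2.2⟩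
    by_contra hn
    rw [← hQ.pos_swap_iff hab hac hbc] at hn
    rcases hPQ.inside_of_flip hP hQ hadm h1 hn with ⟨h, -⟩ | ⟨-, h | h | h⟩
    · exact h.2.2.not_swap h3
    · exact h.1.not_swap h4
    · exact h.1.rotate.not_swap h4
    · exact h.2.1.not_swap h2
  exact ⟨key _ _ _ _ h1 h2 h3 h4, key _ _ _ _ h2 h3 h4 h1, key _ _ _ _ h3 h4 h1 h2,
    key _ _ _ _ h4 h1 h2 h3⟩

lemma SameRadial.inside_of_flip_of_extreme (hPQ : SameRadial P Q) (hP : GenPos P) (hQ : GenPos Q)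
    (hd : ∀ i j k, ¬ Inside Q i j k d) (hda : d ≠ a) (hdb : d ≠ b) (hdc : d ≠ c)
    (hp : Pos P a b c) (hq : Pos Q a c b) :
    Inside P a b c d ∧ (Inside Q d c b a ∨ Inside Q a c d b ∨ Inside Q a d b c) := by
  obtain ⟨hab, hac, hbc⟩ := hp.ne
  rcases hPQ.inside_of_flip hP hQ ⟨hab, hac, hda.symm, hbc, hdb.symm, hdc.symm⟩ hp hq with h | h
  · exact h
  · exact absurd h.1 (hd _ _ _)

/-- Two extreme points cannot lie in the same vertical cone over a triangle of reversed
orientation. -/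
lemma SameRadial.not_inside_and_inside (hPQ : SameRadial P Q) (hP : GenPos P) (hQ : GenPos Q)
    (hd : ∀ i j k, ¬ Inside Q i j k d) (he : ∀ i j k, ¬ Inside Q i j k e) (hde : d ≠ e)
    (hp : Pos P d b c) (hqd : Inside Q d c b a) (hqe : Inside Q e c b a) : False := by
  obtain ⟨-, h | h | h⟩ := hPQ.inside_of_flip_of_extreme hP hQ he hde.symm hqe.pos.ne.2.1
    hqe.pos.ne.1 hp hqd.pos
  · exact hd _ _ _ h
  · exact h.2.1.not_swap hqe.pos.rotate
  · exact h.2.1.not_swap hqe.pos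

/-- A point separated from `d` and `e` by a line through `b` is not inside `d, e, b`. -/
lemma not_inside_of_pos (hc : Pos P b a c) (hd : Pos P a b d) (he : Pos P a b e) :
    ¬ Inside P d e b c := by
  intro h
  have hpos := h.pos
  obtain ⟨-, h2, h3⟩ := h
  have hid : area P b a c * area P d e b +
      area P e b c * area P a b d + area P b d c * area P a b e = 0 := by
    simp only [area, det2, Prod.fst_sub, Prod.snd_sub]; ring
  unfold Pos at *
  have := mul_pos hc hpos
  have := mul_pos h2 hd
  have := mul_pos h3 he
  linarith

/-- If the extreme points `d, e, f` of `Q` lie in the three vertical cones over the reversed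
triangle `a, b, c`, then every configuration which reverses `a, b, c` as well
agrees with `Q` on `d, e, f`. -/
lemma SameRadial.pos_of_reversed (hPQ : SameRadial P Q) (hP : GenPos P) (hQ : GenPos Q)
    (hd : ∀ i j k, ¬ Inside Q i j k d) (he : ∀ i j k, ¬ Inside Q i j k e)
    (hf : ∀ i j k, ¬ Inside Q i j k f) (hnodup : [a, b, c, d, e, f].Nodup)
    (hp : Pos P a b c) (hq : Pos Q a c b)
    (hqd : Inside Q d c b a) (hqe : Inside Q a c e b) (hqf : Inside Q a f b c) :
    Pos Q d f e ∧ ∀ R : α → ℝ × ℝ, GenPos R → SameRadial P R → Pos R a c b → Pos R d f e := by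
  simp only [List.nodup_cons, List.mem_cons, List.not_mem_nil, or_false, not_or,
    List.nodup_nil, not_false_eq_true, and_true] at hnodup
  obtain ⟨⟨hab, hac, had, hae, haf⟩, ⟨hbc, hbd, hbe, hbf⟩, ⟨hcd, hce, hcf⟩, ⟨hde, hdf⟩, hef⟩ :=
    hnodup
  have inside := @fun a b c d => hPQ.inside_of_flip_of_extreme (a := a) (b := b) (c := c) (d := d)
    hP hQ
  obtain ⟨pd1, pd2, pd3⟩ := (inside a b c d hd (Ne.symm had) (Ne.symm hbd) (Ne.symm hcd) hp hq).1
  obtain ⟨pe1, pe2, pe3⟩ := (inside a b c e he (Ne.symm hae) (Ne.symm hbe) (Ne.symm hce) hp hq).1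
  obtain ⟨pf1, pf2, pf3⟩ := (inside a b c f hf (Ne.symm haf) (Ne.symm hbf) (Ne.symm hcf) hp hq).1
  have hdbc : Pos P d b c := pd2.rotate.rotate
  have haec : Pos P a e c := pe3.rotate
  obtain ⟨hdbce, hdbce'⟩ := inside d b c e he (Ne.symm hde) (Ne.symm hbe) (Ne.symm hce) hdbc hqd.pos
  have hdbcf := (inside d b c f hf (Ne.symm hdf) (Ne.symm hbf) (Ne.symm hcf) hdbc hqd.pos).1
  have haecd := (inside a e c d hd (Ne.symm had) hde (Ne.symm hcd) haec hqe.pos).1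
  have haecf := (inside a e c f hf (Ne.symm haf) (Ne.symm hef) (Ne.symm hcf) haec hqe.pos).1
  have habfd := (inside a b f d hd (Ne.symm had) (Ne.symm hbd) hdf pf1 hqf.pos).1
  have habfe := (inside a b f e he (Ne.symm hae) (Ne.symm hbe) hef pf1 hqf.pos).1
  constructor
  · have hQdce : Pos Q d c e := by
      rcases hdbce' with h | h | h
      · exact absurd h (hd _ _ _)
      · exact h.pos
      · exact absurd h (not_inside_of_pos hq.rotate.rotate hqd.2.2.rotate.rotate
          hqe.2.2.rotate)
    obtain ⟨-, h | h | h⟩ := inside d e c f hf (Ne.symm hdf) (Ne.symm hef) (Ne.symm hcf)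
      hdbce.2.2.rotate hQdce
    · exact absurd h (hd _ _ _)
    · exact absurd h (he _ _ _)
    · exact h.pos
  · intro R hR hPR hRabc
    obtain ⟨r1, r2, r3, r4⟩ := hPR.pos_of_convex hP hR pe1 hdbce.1.rotate haecd.1.rotate
      pd1.rotate.rotate
    obtain ⟨r5, r6, r7, r8⟩ := hPR.pos_of_convex hP hR pf2 haecf.2.1.rotate habfe.2.1.rotate
      pe2.rotate.rotate
    obtain ⟨r9, r10, r11, r12⟩ := hPR.pos_of_convex hP hR pd3 habfd.2.2.rotate
      hdbcf.2.2.rotate pf3.rotate.rotate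
    have hRdbc : Pos R d c b := by
      rcases hPR.inside_of_flip hP hR ⟨hab, hac, had, hbc, hbd, hcd⟩ hp hRabc with
        ⟨-, h | h | h⟩ | ⟨h, -⟩
      · exact h.pos
      · exact absurd r9.rotate h.pos.not_swap
      · exact absurd r4.rotate h.pos.not_swap
      · exact absurd r9.rotate h.1.not_swap
    have hRdec : Pos R d c e := by
      rcases hPR.inside_of_flip hP hR ⟨Ne.symm hbd, Ne.symm hcd, hde, hbc, hbe, hce⟩ hdbc hRdbc with
        ⟨-, h | h | h⟩ | ⟨h, -⟩
      · exact absurd r8 h.pos.not_swap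
      · exact h.pos
      · exact absurd r2.rotate.rotate h.pos.not_swap
      · exact absurd r8.rotate.rotate h.2.1.not_swap
    rcases hPR.inside_of_flip hP hR ⟨hde, Ne.symm hcd, hdf, Ne.symm hce, hef, hcf⟩
      hdbce.2.2.rotate hRdec with ⟨-, h | h | h⟩ | ⟨h, -⟩
    · exact absurd r6.rotate h.pos.not_swap
    · exact absurd r11 h.pos.not_swap
    · exact h.pos
    · exact absurd r11 h.1.not_swap

lemma exists_flip_of_extremeSet_ne (hiP : Function.Injective P) (hiQ : Function.Injective Q)
    (hP : GenPos P) (hQ : GenPos Q) (h : ExtremeSet P ≠ ExtremeSet Q) :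
    ∃ i j k, Pos P i j k ∧ Pos Q i k j := by
  by_contra! hn
  refine h (Set.ext fun l => ?_)
  have hpos : ∀ i j k, Pos P i j k ↔ Pos Q i j k := by
    intro i j k
    constructor
    · intro hp
      have hne := hp.ne
      have := hn i j k hp
      rwa [hQ.pos_swap_iff hne.1 hne.2.1 hne.2.2, not_not] at this
    · intro hq
      have hne := hq.ne
      by_contra hp
      rw [← hP.pos_swap_iff hne.1 hne.2.1 hne.2.2] at hp
      exact hn _ _ _ hp hq
  simp only [mem_extremeSet_iff hiP hP, mem_extremeSet_iff hiQ hQ, Inside, hpos]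

lemma SameRadial.pos_swap_of_extremeSet_eq [Finite α] (hPQ : SameRadial P Q)
    (hiP : Function.Injective P) (hiQ : Function.Injective Q) (hP : GenPos P) (hQ : GenPos Q)
    (h : ExtremeSet P ≠ ExtremeSet Q) (habc : ExtremeSet P = {a, b, c}) (hp : Pos P a b c) :
    Pos Q a c b := by
  obtain ⟨i, j, k, h1, h2⟩ := exists_flip_of_extremeSet_ne hiP hiQ hP hQ h
  obtain ⟨x, y, z, hpx, hqx, hx⟩ := hPQ.exists_extremeSet_eq hiP hP hQ h1 h2
  rw [hx] at habc
  have ha : a ∈ ({x, y, z} : Set α) := by simp [habc]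
  have hb : b ∈ ({x, y, z} : Set α) := by simp [habc]
  have hc : c ∈ ({x, y, z} : Set α) := by simp [habc]
  obtain ⟨hab, hac, hbc⟩ := hp.ne
  rcases ha with rfl | rfl | rfl <;> rcases hb with rfl | rfl | rfl <;>
    rcases hc with rfl | rfl | rfl <;>
    first
    | exact absurd rfl hab
    | exact absurd rfl hac
    | exact absurd rfl hbc
    | exact hqx
    | exact hqx.rotate
    | exact hqx.rotate.rotate
    | exact absurd hpx hp.not_swap
    | exact absurd hpx.rotate hp.not_swap
    | exact absurd hpx.rotate.rotate hp.not_swap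

/-- If two configurations with the same radial system have disjoint extreme sets, then both are
triangles, and the extreme set of any further such configuration is one of them. -/
lemma SameRadial.of_disjoint_extremeSet [Finite α] [Nonempty α] (hPQ : SameRadial P Q)
    (hiP : Function.Injective P) (hiQ : Function.Injective Q) (hP : GenPos P) (hQ : GenPos Q)
    (hdisj : Disjoint (ExtremeSet P) (ExtremeSet Q)) :
    (ExtremeSet P).ncard = 3 ∧ (ExtremeSet Q).ncard = 3 ∧
      ∀ R : α → ℝ × ℝ, Function.Injective R → GenPos R → SameRadial P R →
        ExtremeSet R = ExtremeSet P ∨ ExtremeSet R = ExtremeSet Q := by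
  have hne : ExtremeSet P ≠ ExtremeSet Q := fun h => by
    rw [h, disjoint_self] at hdisj
    exact (extremeSet_nonempty hiQ).ne_empty hdisj
  obtain ⟨i, j, k, h1, h2⟩ := exists_flip_of_extremeSet_ne hiP hiQ hP hQ hne
  obtain ⟨a, b, c, hp, hq, hHP⟩ := hPQ.exists_extremeSet_eq hiP hP hQ h1 h2
  obtain ⟨x, y, z, hqx, -, hHQ⟩ := hPQ.symm.exists_extremeSet_eq hiQ hQ hP h2 h1
  obtain ⟨hab, hac, hbc⟩ := hp.ne
  obtain ⟨hxy, hxz, hyz⟩ := hqx.ne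
  have hext : ∀ l ∈ ExtremeSet Q, ∀ i j k, ¬ Inside Q i j k l := fun l =>
    (mem_extremeSet_iff hiQ hQ).1
  have hout : ∀ l ∈ ExtremeSet Q, l ≠ a ∧ l ≠ b ∧ l ≠ c := by
    intro l hl
    have := Set.disjoint_right.1 hdisj hl
    simpa [hHP] using this
  refine ⟨Set.ncard_eq_three.2 ⟨a, b, c, hab, hac, hbc, hHP⟩,
    Set.ncard_eq_three.2 ⟨x, y, z, hxy, hxz, hyz, hHQ⟩, fun R hiR hR hPR => ?_⟩
  by_contra! hRne
  have hcone : ∀ l ∈ ExtremeSet Q, Inside P a b c l ∧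
      (Inside Q l c b a ∨ Inside Q a c l b ∨ Inside Q a l b c) := fun l hl =>
    hPQ.inside_of_flip_of_extreme hP hQ (hext l hl) (hout l hl).1 (hout l hl).2.1 (hout l hl).2.2
      hp hq
  have hA : ∀ l ∈ ExtremeSet Q, ∀ m ∈ ExtremeSet Q, l ≠ m → Inside Q l c b a →
      ¬ Inside Q m c b a := fun l hl m hm hlm h h' =>
    hPQ.not_inside_and_inside hP hQ (hext l hl) (hext m hm) hlm
      (hcone l hl).1.2.1.rotate.rotate h h'
  have hB : ∀ l ∈ ExtremeSet Q, ∀ m ∈ ExtremeSet Q, l ≠ m → Inside Q a c l b →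
      ¬ Inside Q a c m b := fun l hl m hm hlm h h' =>
    hPQ.not_inside_and_inside hP hQ (hext l hl) (hext m hm) hlm
      (hcone l hl).1.2.2.rotate.rotate h.rotate.rotate h'.rotate.rotate
  have hC : ∀ l ∈ ExtremeSet Q, ∀ m ∈ ExtremeSet Q, l ≠ m → Inside Q a l b c →
      ¬ Inside Q a m b c := fun l hl m hm hlm h h' =>
    hPQ.not_inside_and_inside hP hQ (hext l hl) (hext m hm) hlm
      (hcone l hl).1.1.rotate.rotate h.rotate h'.rotate
  have hRa : Pos R a c b :=
    hPR.pos_swap_of_extremeSet_eq hiP hiR hP hR hRne.1.symm hHP hp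
  have main : ∀ d e f, d ≠ e → d ≠ f → e ≠ f → ExtremeSet Q = {d, e, f} → Inside Q d c b a →
      Inside Q a c e b → Inside Q a f b c → False := by
    intro d e f hde hdf hef hH hqd hqe hqf
    have hd : d ∈ ExtremeSet Q := by simp [hH]
    have he : e ∈ ExtremeSet Q := by simp [hH]
    have hf : f ∈ ExtremeSet Q := by simp [hH]
    have hd' := hout d hd
    have he' := hout e he
    have hf' := hout f hf
    obtain ⟨h3, h4⟩ := hPQ.pos_of_reversed hP hQ (hext d hd) (hext e he) (hext f hf)
      (by simp only [List.nodup_cons, List.mem_cons, List.not_mem_nil]; grind) hp hq hqd hqe hqf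
    have hdfe : ExtremeSet Q = {d, f, e} := by rw [hH, Set.pair_comm e f]
    exact (h4 R hR hPR hRa).not_swap
      ((hPQ.symm.trans hPR).pos_swap_of_extremeSet_eq hiQ hiR hQ hR hRne.2.symm hdfe h3)
  have hx : x ∈ ExtremeSet Q := by simp [hHQ]
  have hy : y ∈ ExtremeSet Q := by simp [hHQ]
  have hz : z ∈ ExtremeSet Q := by simp [hHQ]
  have hcomm : ∀ x y z : α, ({x, y, z} : Set α) = {y, z, x} := fun x y z => by
    ext; simp only [Set.mem_insert_iff, Set.mem_singleton_iff]; tauto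
  have hcomm' : ∀ x y z : α, ({x, y, z} : Set α) = {x, z, y} := fun x y z => by
    rw [Set.pair_comm]
  have hxyz := main x y z hxy hxz hyz hHQ
  have hxzy := main x z y hxz hxy hyz.symm (hHQ.trans (hcomm' _ _ _))
  have hyzx := main y z x hyz hxy.symm hxz.symm (hHQ.trans (hcomm _ _ _))
  have hyxz := main y x z hxy.symm hyz hxz ((hHQ.trans (hcomm _ _ _)).trans (hcomm' _ _ _))
  have hzxy := main z x y hxz.symm hyz.symm hxy ((hHQ.trans (hcomm _ _ _)).trans (hcomm _ _ _))
  have hzyx := main z y x hyz.symm hxz.symm hxy.symm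
    (((hHQ.trans (hcomm _ _ _)).trans (hcomm _ _ _)).trans (hcomm' _ _ _))
  have hA1 := hA x hx y hy hxy
  have hA2 := hA x hx z hz hxz
  have hA3 := hA y hy z hz hyz
  have hB1 := hB x hx y hy hxy
  have hB2 := hB x hx z hz hxz
  have hB3 := hB y hy z hz hyz
  have hC1 := hC x hx y hy hxy
  have hC2 := hC x hx z hz hxz
  have hC3 := hC y hy z hz hyz
  have hx' := (hcone x hx).2
  have hy' := (hcone y hy).2
  have hz' := (hcone z hz).2
  clear hcone hA hB hC main hout hext hcomm hcomm'
  grind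

end Orientation

/-- two disjoint important sets are both triangles, and they are
the only important sets. -/
theorem disjoint_important_sets {n : ℕ} (hn : 5 ≤ n)
    (P₀ : Fin n → ℝ × ℝ)
    (hinj : Function.Injective P₀) (hgp : GenPos P₀)
    (H₁ H₂ : Set (Fin n))
    (h₁ : Important P₀ H₁) (h₂ : Important P₀ H₂)
    (hdisj : Disjoint H₁ H₂) :
    H₁.ncard = 3 ∧ H₂.ncard = 3 ∧
      ∀ H : Set (Fin n), Important P₀ H → H = H₁ ∨ H = H₂ := by
  obtain ⟨P, hiP, hP, hP₀P, rfl⟩ := h₁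
  obtain ⟨Q, hiQ, hQ, hP₀Q, rfl⟩ := h₂
  have : Nonempty (Fin n) := ⟨⟨0, by omega⟩⟩
  obtain ⟨h1, h2, h3⟩ :=
    (hP₀P.symm.trans hP₀Q).of_disjoint_extremeSet hiP hiQ hP hQ hdisj
  refine ⟨h1, h2, ?_⟩
  rintro _ ⟨R, hiR, hR, hP₀R, rfl⟩
  exact h3 R hiR hR (hP₀P.symm.trans hP₀R)
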